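/- arXiv:1802.06380 — 4 statements merged into one kernel-verified Lean document; each statement's English description precedes it below -/
import Mathlib

section
/- Let Z⁻ > 0, Z⁺ > 0, α ≥ 0, and let q⁻, p⁺ be real numbers. Define η = Z⁻ Z⁺/(Z⁻ + Z⁺), Φ = η(2 p⁺/Z⁺ − 2 q⁻/Z⁻), σ̂ = α Φ/(η + α), v̂⁺ = (2 p⁺ − σ̂)/Z⁺, v̂⁻ = (2 q⁻ + σ̂)/Z⁻, q̂⁺ = ½(Z⁺ v̂⁺ − σ̂), and p̂⁻ = ½(Z⁻ v̂⁻ + σ̂). Then (1/Z⁺)((p⁺)² − (q̂⁺)²) + (1/Z⁻)((q⁻)² − (p̂⁻)²) = σ̂ (v̂⁺ − v̂⁻) = α Φ²/(η + α)², and in particular this quantity is nonnegative. -/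
/-- the frictional dissipation identity at an interface:
`(1/Z⁺)((p⁺)² − (q̂⁺)²) + (1/Z⁻)((q⁻)² − (p̂⁻)²) = σ̂(v̂⁺ − v̂⁻) = αΦ²/(η+α)² ≥ 0`. -/
theorem stmt_10 (Zm Zp α qm pp η Φ σh vhp vhm qhp phm : ℝ)
    (hZm : 0 < Zm) (hZp : 0 < Zp) (hα : 0 ≤ α)
    (hη : η = Zm * Zp / (Zm + Zp))
    (hΦ : Φ = η * (2 * pp / Zp - 2 * qm / Zm))
    (hσh : σh = α * Φ / (η + α))
    (hvhp : vhp = (2 * pp - σh) / Zp) (hvhm : vhm = (2 * qm + σh) / Zm)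
    (hqhp : qhp = 1/2 * (Zp * vhp - σh)) (hphm : phm = 1/2 * (Zm * vhm + σh)) :
    (1/Zp) * (pp^2 - qhp^2) + (1/Zm) * (qm^2 - phm^2) = σh * (vhp - vhm) ∧
    σh * (vhp - vhm) = α * Φ^2 / (η + α)^2 ∧
    0 ≤ (1/Zp) * (pp^2 - qhp^2) + (1/Zm) * (qm^2 - phm^2) := by
  have hη_pos : 0 < η := by rw [hη]; positivity
  have hsum : 0 < η + α := by linarith
  have energy : (1/Zp) * (pp^2 - qhp^2) + (1/Zm) * (qm^2 - phm^2) = σh * (vhp - vhm) := by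
    rw [hqhp, hphm, hvhp, hvhm]
    field_simp
    ring
  have hη_inv : 1 / Zp + 1 / Zm = 1 / η := by
    rw [hη]
    field_simp
  have jump : vhp - vhm = Φ / (η + α) := by
    have hdrive : 2 * pp / Zp - 2 * qm / Zm = Φ / η := by
      rw [hΦ]
      field_simp
    calc vhp - vhm = (2 * pp / Zp - 2 * qm / Zm) - σh * (1 / Zp + 1 / Zm) := by
          rw [hvhp, hvhm]; ring
      _ = Φ / (η + α) := by
          rw [hdrive, hη_inv, hσh]
          field_simp
          ring
  have work : σh * (vhp - vhm) = α * Φ^2 / (η + α)^2 := by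
    rw [jump, hσh]
    field_simp
  refine ⟨energy, work, ?_⟩
  rw [energy, work]
  positivity
end

section
/- Let N ≥ 1 and let 𝓛₁, …, 𝓛_{N+1} be real polynomials each of degree at most N. Let ξ₁, …, ξ_{N+1} ∈ [−1,1] and w₁, …, w_{N+1} ∈ ℝ be quadrature nodes and weights such that ∑_{m=1}^{N+1} w_m P(ξ_m) = ∫_{−1}^{1} P(ξ) dξ for every real polynomial P of degree at most 2N−1. Define the (N+1)×(N+1) matrices Q_{ij} = ∑_{m=1}^{N+1} w_m 𝓛_i(ξ_m) 𝓛_j′(ξ_m) and B_{ij} = 𝓛_j(1) 𝓛_i(1) − 𝓛_j(−1) 𝓛_i(−1). Then Q + Qᵀ = B, that is, Q_{ij} + Q_{ji} = B_{ij} for all i, j. -/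
open Polynomial in
/-- The fundamental theorem of calculus for real polynomials. -/
theorem Polynomial.integral_eval_derivative (p : ℝ[X]) (a b : ℝ) :
    ∫ x in a..b, p.derivative.eval x = p.eval b - p.eval a :=
  intervalIntegral.integral_eq_sub_of_hasDerivAt (fun x _ => p.hasDerivAt x)
    (p.derivative.continuous.intervalIntegrable a b)

/-- the summation-by-parts property `Q + Qᵀ = B` of the quadrature-based
elemental stiffness matrix. -/
theorem stmt_13 (N : ℕ) (hN : 1 ≤ N)
    (𝓛 : Fin (N+1) → Polynomial ℝ) (hdeg : ∀ i, (𝓛 i).natDegree ≤ N)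
    (ξ : Fin (N+1) → ℝ) (hξ : ∀ m, ξ m ∈ Set.Icc (-1:ℝ) 1)
    (w : Fin (N+1) → ℝ)
    (hquad : ∀ P : Polynomial ℝ, P.natDegree ≤ 2*N - 1 →
      ∑ m, w m * P.eval (ξ m) = ∫ x in (-1:ℝ)..1, P.eval x)
    (Q B : Matrix (Fin (N+1)) (Fin (N+1)) ℝ)
    (hQ : ∀ i j, Q i j = ∑ m, w m * (𝓛 i).eval (ξ m) * ((𝓛 j).derivative.eval (ξ m)))
    (hB : ∀ i j, B i j = (𝓛 j).eval 1 * (𝓛 i).eval 1 - (𝓛 j).eval (-1) * (𝓛 i).eval (-1)) :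
    ∀ i j, Q i j + Q j i = B i j := by
  intro i j
  have hd : (Polynomial.derivative (𝓛 i * 𝓛 j)).natDegree ≤ 2 * N - 1 := by
    have h₁ := Polynomial.natDegree_derivative_le (𝓛 i * 𝓛 j)
    have h₂ := Polynomial.natDegree_mul_le (p := 𝓛 i) (q := 𝓛 j)
    have h₃ := hdeg i
    have h₄ := hdeg j
    omega
  have h := hquad _ hd
  rw [Polynomial.integral_eval_derivative, Polynomial.derivative_mul] at h
  simp only [Polynomial.eval_add, Polynomial.eval_mul] at h
  rw [hQ, hQ, hB, ← Finset.sum_add_distrib]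
  calc
    _ = ∑ m, w m * ((𝓛 i).derivative.eval (ξ m) * (𝓛 j).eval (ξ m)
          + (𝓛 i).eval (ξ m) * (𝓛 j).derivative.eval (ξ m)) :=
        Finset.sum_congr rfl fun m _ => by ring
    _ = _ := by rw [h]; ring
end

section
/- Fix K ≥ 1 and a partition 0 = x₁ < x₂ < ⋯ < x_{K+1} = L. On each element [x_k, x_{k+1}] let ρ_k, μ_k : [x_k, x_{k+1}] → ℝ be continuous and strictly positive with impedance Z_k = √(ρ_k μ_k), and let v_k, σ_k : [x_k, x_{k+1}] × [0,∞) → ℝ be continuously differentiable. Let r₀, r_L ∈ [−1,1], and for each interior node x_k (2 ≤ k ≤ K) let α_k ≥ 0. Define at each interior node x_k: Z⁻ = Z_{k−1}(x_k), Z⁺ = Z_k(x_k), q⁻_k = ½(Z⁻ v_{k−1}(x_k,t) − σ_{k−1}(x_k,t)), p⁺_k = ½(Z⁺ v_k(x_k,t) + σ_k(x_k,t)), η_k = Z⁻Z⁺/(Z⁻+Z⁺), Φ_k = η_k(2p⁺_k/Z⁺ − 2q⁻_k/Z⁻), σ̂_k = α_kΦ_k/(η_k+α_k), v̂⁻_k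 = (2q⁻_k + σ̂_k)/Z⁻, v̂⁺_k = (2p⁺_k − σ̂_k)/Z⁺. At x₁ define p₀ = ½(Z₁(x₁)v₁(x₁,t) + σ₁(x₁,t)), v̂₁ = (1+r₀)p₀/Z₁(x₁), σ̂₁ = (1−r₀)p₀; at x_{K+1} define q_L = ½(Z_K(x_{K+1})v_K(x_{K+1},t) − σ_K(x_{K+1},t)), v̂_{K+1} = (1+r_L)q_L/Z_K(x_{K+1}), σ̂_{K+1} = −(1−r_L)q_L. Define the flux fluctuations F(x_k,t) = (Z_k(x_k)/2)(v_k(x_k,t) − v̂_k) − ½(σ_k(x_k,t) − σ̂_k), with v̂_k = v̂⁺_k, σ̂_k = σ̂_k for 2 ≤ k ≤ K, and G(x_{k+1},t) = (Z_k(x_{k+1})/2)(v_k(x_{k+1},t) − v̂_{k+1}) + ½(σ_k(x_{k+1},t) − σ̂_{k+1}), with v̂_{k+1} = v̂⁻_{k+1}, σ̂_{k+1} = σ̂_{k+1} for 2 ≤ k+1 ≤ K. Assume that for every t ≥ 0 and every k = 1,…,K the penalized variational identities hold with the solution itself as test function: ∫_{x_k}^{x_{k+1}} ( ρ_k v_k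 ∂v_k/∂t − v_k ∂σ_k/∂x ) dx + v_k(x_k,t)F(x_k,t) + v_k(x_{k+1},t)G(x_{k+1},t) = 0 and ∫_{x_k}^{x_{k+1}} ( (1/μ_k) σ_k ∂σ_k/∂t − σ_k ∂v_k/∂x ) dx − (σ_k(x_k,t)/Z_k(x_k))F(x_k,t) + (σ_k(x_{k+1},t)/Z_k(x_{k+1}))G(x_{k+1},t) = 0. Then the total energy E(t) = ∑_{k=1}^{K} ½ ∫_{x_k}^{x_{k+1}} ( ρ_k v_k² + σ_k²/μ_k ) dx satisfies, for every t ≥ 0, E′(t) = −∑_{k=1}^{K} ( F(x_k,t)²/Z_k(x_k) + G(x_{k+1},t)²/Z_k(x_{k+1}) ) − ∑_{k=2}^{K} α_k Φ_k²/(η_k+α_k)² − (1−r₀²) p₀²/Z₁(x₁) − (1−r_L²) q_L²/Z_K(x_{K+1}). -/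
open Set MeasureTheory Filter Topology Interval

/-- Differentiation under the integral sign on a half-line, with one-sided derivative at `0`. -/
theorem hasDerivWithinAt_integral_Ici {a b : ℝ} (hab : a ≤ b) {f f' : ℝ → ℝ → ℝ}
    (hf : ∀ t ∈ Ici (0 : ℝ), ContinuousOn (fun y => f y t) (Icc a b))
    (hf' : ContinuousOn (fun p : ℝ × ℝ => f' p.1 p.2) (Icc a b ×ˢ Ici 0))
    (hd : ∀ y ∈ Icc a b, ∀ t ∈ Ici (0 : ℝ), HasDerivWithinAt (f y) (f' y t) (Ici 0) t)
    {t : ℝ} (ht : t ∈ Ici (0 : ℝ)) :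
    HasDerivWithinAt (fun s => ∫ y in a..b, f y s) (∫ y in a..b, f' y t) (Ici 0) t := by
  have hint : ∀ s ∈ Ici (0 : ℝ), IntervalIntegrable (fun y => f y s) volume a b := fun s hs =>
    ContinuousOn.intervalIntegrable_of_Icc hab (hf s hs)
  obtain ⟨C, hC⟩ := (isCompact_Icc.prod isCompact_Icc).exists_bound_of_continuousOn
    (hf'.mono (prod_mono_right (Icc_subset_Ici_self : Icc 0 (t + 1) ⊆ Ici 0)))
  have hnear : ∀ᶠ s in 𝓝[Ici 0 \ {t}] t, s ∈ Icc 0 (t + 1) := by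
    have h1 : ∀ᶠ s in 𝓝[Ici 0 \ {t}] t, s < t + 1 :=
      nhdsWithin_le_nhds (Iio_mem_nhds (lt_add_one t))
    filter_upwards [h1, self_mem_nhdsWithin] with s hs hs'
    exact ⟨hs'.1, hs.le⟩
  have hsub : Ι a b ⊆ Icc a b := by
    rw [uIoc_of_le hab]
    exact Ioc_subset_Icc_self
  rw [hasDerivWithinAt_iff_tendsto_slope]
  have key : Tendsto (fun s => ∫ y in a..b, slope (f y) t s) (𝓝[Ici 0 \ {t}] t)
      (𝓝 (∫ y in a..b, f' y t)) := by
    refine intervalIntegral.tendsto_integral_filter_of_dominated_convergence (fun _ => C) ?_ ?_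
      intervalIntegrable_const ?_
    · filter_upwards [hnear] with s hs
      simp only [slope_def_field]
      exact (IntervalIntegrable.div_const ((hint s hs.1).sub (hint t ht)) _).aestronglyMeasurable_restrict_uIoc
    · filter_upwards [hnear, self_mem_nhdsWithin] with s hs hs'
      refine ae_of_all _ fun y hy => ?_
      have hst : 0 < ‖s - t‖ := norm_pos_iff.2 (sub_ne_zero.2 hs'.2)
      rw [slope_def_field, norm_div, div_le_iff₀ hst]
      refine (convex_Icc 0 (t + 1)).norm_image_sub_le_of_norm_hasDerivWithin_le (f' := f' y)
        (fun u hu => (hd y (hsub hy) u hu.1).mono Icc_subset_Ici_self)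
        (fun u hu => hC (y, u) ⟨hsub hy, hu⟩) ⟨ht, by linarith⟩ hs
    · exact ae_of_all _ fun y hy => hasDerivWithinAt_iff_tendsto_slope.1 (hd y (hsub hy) t ht)
  refine key.congr' ?_
  filter_upwards [hnear] with s hs
  simp only [slope_def_field]
  rw [intervalIntegral.integral_div, intervalIntegral.integral_sub (hint s hs.1) (hint t ht)]

/-- Partial derivatives of a `C¹` function on a strip: existence and continuity. -/
theorem ContDiffOn.partial_derivWithin {a b : ℝ} (hab : a < b) {u : ℝ → ℝ → ℝ}
    (hu : ContDiffOn ℝ 1 (fun p : ℝ × ℝ => u p.1 p.2) (Icc a b ×ˢ Ici 0)) :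
    (∀ y ∈ Icc a b, ∀ t ∈ Ici (0 : ℝ),
      HasDerivWithinAt (u y) (derivWithin (fun s => u y s) (Ici 0) t) (Ici 0) t) ∧
    (∀ y ∈ Icc a b, ∀ t ∈ Ici (0 : ℝ), HasDerivWithinAt (fun z => u z t)
      (derivWithin (fun z => u z t) (Icc a b) y) (Icc a b) y) ∧
    ContinuousOn (fun p : ℝ × ℝ => derivWithin (fun s => u p.1 s) (Ici 0) p.2)
      (Icc a b ×ˢ Ici 0) ∧
    ContinuousOn (fun p : ℝ × ℝ => derivWithin (fun z => u z p.2) (Icc a b) p.1)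
      (Icc a b ×ˢ Ici 0) := by
  have hU : UniqueDiffOn ℝ (Icc a b ×ˢ Ici (0 : ℝ)) :=
    (uniqueDiffOn_Icc hab).prod (uniqueDiffOn_Ici 0)
  have hc := hu.continuousOn_fderivWithin hU le_rfl
  have hfd : ∀ p ∈ Icc a b ×ˢ Ici (0 : ℝ), HasFDerivWithinAt (fun p : ℝ × ℝ => u p.1 p.2)
      (fderivWithin ℝ (fun p : ℝ × ℝ => u p.1 p.2) (Icc a b ×ˢ Ici 0) p) (Icc a b ×ˢ Ici 0) p :=
    fun p hp => (hu.differentiableOn one_ne_zero p hp).hasFDerivWithinAt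
  have htime : ∀ y ∈ Icc a b, ∀ t ∈ Ici (0 : ℝ), HasDerivWithinAt (u y)
      (fderivWithin ℝ (fun p : ℝ × ℝ => u p.1 p.2) (Icc a b ×ˢ Ici 0) (y, t) (0, 1))
      (Ici 0) t := fun y hy t ht =>
    (hfd (y, t) ⟨hy, ht⟩).comp_hasDerivWithinAt (f := fun s => (y, s)) t
      ((hasDerivWithinAt_const t _ y).prodMk (hasDerivWithinAt_id t _)) fun s hs => ⟨hy, hs⟩
  have hspace : ∀ y ∈ Icc a b, ∀ t ∈ Ici (0 : ℝ), HasDerivWithinAt (fun z => u z t)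
      (fderivWithin ℝ (fun p : ℝ × ℝ => u p.1 p.2) (Icc a b ×ˢ Ici 0) (y, t) (1, 0))
      (Icc a b) y := fun y hy t ht =>
    (hfd (y, t) ⟨hy, ht⟩).comp_hasDerivWithinAt (f := fun z => (z, t)) y
      ((hasDerivWithinAt_id y _).prodMk (hasDerivWithinAt_const y _ t)) fun z hz => ⟨hz, ht⟩
  refine ⟨fun y hy t ht => (htime y hy t ht).differentiableWithinAt.hasDerivWithinAt,
    fun y hy t ht => (hspace y hy t ht).differentiableWithinAt.hasDerivWithinAt, ?_, ?_⟩
  · exact (hc.clm_apply continuousOn_const).congr fun p hp =>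
      (htime p.1 hp.1 p.2 hp.2).derivWithin (uniqueDiffOn_Ici 0 p.2 hp.2)
  · exact (hc.clm_apply continuousOn_const).congr fun p hp =>
      (hspace p.1 hp.1 p.2 hp.2).derivWithin (uniqueDiffOn_Icc hab p.1 hp.1)

/-- Energy rate on a single element, when the weak form carries boundary terms `P` and `Q`. -/
theorem hasDerivWithinAt_element_energy {a b : ℝ} (hab : a < b) {ρ μ : ℝ → ℝ}
    (hρ : ContinuousOn ρ (Icc a b)) (hμ : ContinuousOn μ (Icc a b))
    (hμpos : ∀ y ∈ Icc a b, 0 < μ y) {v σ : ℝ → ℝ → ℝ}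
    (hv : ContDiffOn ℝ 1 (fun p : ℝ × ℝ => v p.1 p.2) (Icc a b ×ˢ Ici 0))
    (hσ : ContDiffOn ℝ 1 (fun p : ℝ × ℝ => σ p.1 p.2) (Icc a b ×ˢ Ici 0))
    {t : ℝ} (ht : t ∈ Ici (0 : ℝ)) {P Q : ℝ}
    (hP : (∫ y in a..b, (ρ y * v y t * derivWithin (fun s => v y s) (Ici 0) t
      - v y t * derivWithin (fun z => σ z t) (Icc a b) y)) + P = 0)
    (hQ : (∫ y in a..b, ((1 / μ y) * σ y t * derivWithin (fun s => σ y s) (Ici 0) t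
      - σ y t * derivWithin (fun z => v z t) (Icc a b) y)) + Q = 0) :
    HasDerivWithinAt
      (fun t => 1 / 2 * ∫ y in a..b, (ρ y * (v y t) ^ 2 + (σ y t) ^ 2 / μ y))
      (v b t * σ b t - v a t * σ a t - P - Q) (Ici 0) t := by
  obtain ⟨hvt, hvx, cvt, cvx⟩ := hv.partial_derivWithin hab
  obtain ⟨hσt, hσx, cσt, cσx⟩ := hσ.partial_derivWithin hab
  have hμ0 : ∀ y ∈ Icc a b, μ y ≠ 0 := fun y hy => (hμpos y hy).ne'
  have slice : ∀ {g : ℝ × ℝ → ℝ}, ContinuousOn g (Icc a b ×ˢ Ici 0) → ∀ s ∈ Ici (0 : ℝ),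
      ContinuousOn (fun y => g (y, s)) (Icc a b) := fun hg s hs =>
    hg.comp (by fun_prop) fun y hy => ⟨hy, hs⟩
  have lift : ∀ {g : ℝ → ℝ}, ContinuousOn g (Icc a b) →
      ContinuousOn (fun p : ℝ × ℝ => g p.1) (Icc a b ×ˢ Ici 0) := fun hg =>
    hg.comp continuousOn_fst fun p hp => hp.1
  have iμ : ContinuousOn (fun y => 1 / μ y) (Icc a b) := continuousOn_const.div hμ hμ0
  have ii : ∀ {g : ℝ → ℝ}, ContinuousOn g (Icc a b) → IntervalIntegrable g volume a b :=
    fun hg => hg.intervalIntegrable_of_Icc hab.le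
  have i1 : IntervalIntegrable
      (fun y => ρ y * v y t * derivWithin (fun s => v y s) (Ici 0) t) volume a b :=
    ii (slice (((lift hρ).mul hv.continuousOn).mul cvt) t ht)
  have i2 : IntervalIntegrable
      (fun y => v y t * derivWithin (fun z => σ z t) (Icc a b) y) volume a b :=
    ii (slice (hv.continuousOn.mul cσx) t ht)
  have i3 : IntervalIntegrable
      (fun y => (1 / μ y) * σ y t * derivWithin (fun s => σ y s) (Ici 0) t) volume a b :=
    ii (slice (((lift iμ).mul hσ.continuousOn).mul cσt) t ht)
  have i4 : IntervalIntegrable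
      (fun y => σ y t * derivWithin (fun z => v z t) (Icc a b) y) volume a b :=
    ii (slice (hσ.continuousOn.mul cvx) t ht)
  have hD := hasDerivWithinAt_integral_Ici hab.le
    (f := fun y t => ρ y * (v y t) ^ 2 + (σ y t) ^ 2 / μ y)
    (f' := fun y t => 2 * (ρ y * v y t * derivWithin (fun s => v y s) (Ici 0) t
      + (1 / μ y) * σ y t * derivWithin (fun s => σ y s) (Ici 0) t))
    (fun s hs => (hρ.mul ((slice hv.continuousOn s hs).pow 2)).add
      (((slice hσ.continuousOn s hs).pow 2).div hμ hμ0))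
    (continuousOn_const.mul ((((lift hρ).mul hv.continuousOn).mul cvt).add
      (((lift iμ).mul hσ.continuousOn).mul cσt)))
    (fun y hy s hs => by
      refine ((((hvt y hy s hs).pow 2).const_mul (ρ y)).add
        (((hσt y hy s hs).pow 2).div_const (μ y))).congr_deriv ?_
      simp
      ring)
    ht
  have hparts : (∫ y in a..b, (derivWithin (fun z => v z t) (Icc a b) y * σ y t
      + v y t * derivWithin (fun z => σ z t) (Icc a b) y)) = v b t * σ b t - v a t * σ a t := by
    refine intervalIntegral.integral_deriv_mul_eq_sub_of_hasDerivWithinAt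
      (u := fun y => v y t) (v := fun y => σ y t) ?_ ?_
      (ii (slice cvx t ht)) (ii (slice cσx t ht)) <;> rw [uIcc_of_le hab.le]
    · exact fun y hy => hvx y hy t ht
    · exact fun y hy => hσx y hy t ht
  refine (hD.const_mul (1 / 2)).congr_deriv ?_
  have hsplit : (∫ y in a..b, (derivWithin (fun z => v z t) (Icc a b) y * σ y t
      + v y t * derivWithin (fun z => σ z t) (Icc a b) y))
      = (∫ y in a..b, σ y t * derivWithin (fun z => v z t) (Icc a b) y)
      + ∫ y in a..b, v y t * derivWithin (fun z => σ z t) (Icc a b) y := by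
    rw [← intervalIntegral.integral_add i4 i2]
    simp only [mul_comm (σ _ t)]
  rw [intervalIntegral.integral_sub i1 i2] at hP
  rw [intervalIntegral.integral_sub i3 i4] at hQ
  rw [intervalIntegral.integral_const_mul, intervalIntegral.integral_add i1 i3]
  linarith

/-- At a left node, where the hat-variables `vh, σh` preserve the characteristic `Z v + σ`,
the boundary energy flux equals dissipation minus the flux of the hat-variables. -/
theorem left_node_energy_flux {Z v σ vh σh F : ℝ} (hZ : Z ≠ 0)
    (hp : Z * vh + σh = Z * v + σ) (hF : F = Z / 2 * (v - vh) - 1 / 2 * (σ - σh)) :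
    -(v * σ) - v * F + σ / Z * F = -(F ^ 2 / Z) - vh * σh := by
  obtain rfl : σh = Z * v + σ - Z * vh := by linarith
  subst hF
  field_simp
  ring

/-- At a right node, where the hat-variables `vh, σh` preserve the characteristic `Z v - σ`,
the boundary energy flux equals dissipation plus the flux of the hat-variables. -/
theorem right_node_energy_flux {Z v σ vh σh G : ℝ} (hZ : Z ≠ 0)
    (hq : Z * vh - σh = Z * v - σ) (hG : G = Z / 2 * (v - vh) + 1 / 2 * (σ - σh)) :
    v * σ - v * G - σ / Z * G = -(G ^ 2 / Z) + vh * σh := by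
  obtain rfl : σh = Z * vh - (Z * v - σ) := by linarith
  subst hG
  field_simp
  ring

/-- Work done by friction at an interface. -/
theorem friction_work {Zm Zp q p α η Φ σh : ℝ} (hm : 0 < Zm) (hp : 0 < Zp) (hα : 0 ≤ α)
    (hη : η = Zm * Zp / (Zm + Zp)) (hΦ : Φ = η * (2 * p / Zp - 2 * q / Zm))
    (hσh : σh = α * Φ / (η + α)) :
    (2 * p - σh) / Zp * σh - (2 * q + σh) / Zm * σh = α * Φ ^ 2 / (η + α) ^ 2 := by
  have hη0 : 0 < η := hη ▸ by positivity
  have hηα : η + α ≠ 0 := by positivity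
  have hinv : 1 / Zp + 1 / Zm = 1 / η := by
    rw [hη]
    field_simp
  have hjump : 2 * p / Zp - 2 * q / Zm = Φ / η := by
    rw [hΦ]
    field_simp
  calc (2 * p - σh) / Zp * σh - (2 * q + σh) / Zm * σh
      = ((2 * p / Zp - 2 * q / Zm) - σh * (1 / Zp + 1 / Zm)) * σh := by ring
    _ = α * Φ ^ 2 / (η + α) ^ 2 := by
      rw [hinv, hjump, hσh]
      field_simp
      ring

/-- Regroup element contributions `b k - a k` by nodes. -/
theorem sum_range_succ_sub_eq_nodes (n : ℕ) (a b : ℕ → ℝ) :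
    ∑ k ∈ Finset.range (n + 1), (b k - a k)
      = b n - a 0 - ∑ i ∈ Finset.Icc 1 n, (a i - b (i - 1)) := by
  induction n with
  | zero => simp
  | succ n ih =>
    rw [Finset.sum_range_succ, ih, Finset.sum_Icc_succ_top (by omega), Nat.add_sub_cancel]
    ring

/-- Theorem 1 of the paper: the energy identity for the penalized
weak form of the 1D elastic wave equation with physically motivated fluxes.
Elements are indexed `k = 0, …, K-1` (element `k` spans `[x k, x (k+1)]`);
interior nodes (between elements `i-1` and `i`) are indexed `i = 1, …, K-1`. -/
theorem stmt_14 (K : ℕ) (hK : 1 ≤ K) (L : ℝ) (hL : 0 < L)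
    (x : ℕ → ℝ) (hx0 : x 0 = 0) (hxK : x K = L)
    (hxmono : ∀ k, k < K → x k < x (k+1))
    (ρ μ : ℕ → ℝ → ℝ)
    (hρc : ∀ k, k < K → ContinuousOn (ρ k) (Set.Icc (x k) (x (k+1))))
    (hμc : ∀ k, k < K → ContinuousOn (μ k) (Set.Icc (x k) (x (k+1))))
    (hρpos : ∀ k, k < K → ∀ y ∈ Set.Icc (x k) (x (k+1)), 0 < ρ k y)
    (hμpos : ∀ k, k < K → ∀ y ∈ Set.Icc (x k) (x (k+1)), 0 < μ k y)
    (Z : ℕ → ℝ → ℝ) (hZ : ∀ k y, Z k y = Real.sqrt (ρ k y * μ k y))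
    (v σ : ℕ → ℝ → ℝ → ℝ)
    (hv : ∀ k, k < K → ContDiffOn ℝ 1 (fun p : ℝ × ℝ => v k p.1 p.2)
      (Set.Icc (x k) (x (k+1)) ×ˢ Set.Ici 0))
    (hσ : ∀ k, k < K → ContDiffOn ℝ 1 (fun p : ℝ × ℝ => σ k p.1 p.2)
      (Set.Icc (x k) (x (k+1)) ×ˢ Set.Ici 0))
    (r₀ rL : ℝ) (hr₀ : r₀ ∈ Set.Icc (-1:ℝ) 1) (hrL : rL ∈ Set.Icc (-1:ℝ) 1)
    (α : ℕ → ℝ) (hα : ∀ i, 1 ≤ i → i ≤ K - 1 → 0 ≤ α i)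
    -- outgoing characteristics at the interior node `x i` (`1 ≤ i ≤ K-1`)
    (qm pp : ℕ → ℝ → ℝ)
    (hqm : ∀ i, 1 ≤ i → i ≤ K - 1 → ∀ t,
      qm i t = 1/2 * (Z (i-1) (x i) * v (i-1) (x i) t - σ (i-1) (x i) t))
    (hpp : ∀ i, 1 ≤ i → i ≤ K - 1 → ∀ t,
      pp i t = 1/2 * (Z i (x i) * v i (x i) t + σ i (x i) t))
    (η : ℕ → ℝ)
    (hη : ∀ i, 1 ≤ i → i ≤ K - 1 →
      η i = Z (i-1) (x i) * Z i (x i) / (Z (i-1) (x i) + Z i (x i)))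
    (Φ : ℕ → ℝ → ℝ)
    (hΦ : ∀ i, 1 ≤ i → i ≤ K - 1 → ∀ t,
      Φ i t = η i * (2 * pp i t / Z i (x i) - 2 * qm i t / Z (i-1) (x i)))
    (σh : ℕ → ℝ → ℝ)
    (hσh : ∀ i, 1 ≤ i → i ≤ K - 1 → ∀ t, σh i t = α i * Φ i t / (η i + α i))
    (vhm vhp : ℕ → ℝ → ℝ)
    (hvhm : ∀ i, 1 ≤ i → i ≤ K - 1 → ∀ t,
      vhm i t = (2 * qm i t + σh i t) / Z (i-1) (x i))
    (hvhp : ∀ i, 1 ≤ i → i ≤ K - 1 → ∀ t,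
      vhp i t = (2 * pp i t - σh i t) / Z i (x i))
    -- outgoing characteristics at the external boundaries
    (p₀ qL : ℝ → ℝ)
    (hp₀ : ∀ t, p₀ t = 1/2 * (Z 0 (x 0) * v 0 (x 0) t + σ 0 (x 0) t))
    (hqL : ∀ t, qL t = 1/2 * (Z (K-1) (x K) * v (K-1) (x K) t - σ (K-1) (x K) t))
    -- flux fluctuations: `F k` acts at the left node of element `k`,
    -- `G k` acts at the right node of element `k`
    (F G : ℕ → ℝ → ℝ)
    (hF0 : ∀ t, F 0 t
      = Z 0 (x 0) / 2 * (v 0 (x 0) t - (1 + r₀) * p₀ t / Z 0 (x 0))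
        - 1/2 * (σ 0 (x 0) t - (1 - r₀) * p₀ t))
    (hFi : ∀ k, 1 ≤ k → k ≤ K - 1 → ∀ t, F k t
      = Z k (x k) / 2 * (v k (x k) t - vhp k t) - 1/2 * (σ k (x k) t - σh k t))
    (hGi : ∀ k, k < K - 1 → ∀ t, G k t
      = Z k (x (k+1)) / 2 * (v k (x (k+1)) t - vhm (k+1) t)
        + 1/2 * (σ k (x (k+1)) t - σh (k+1) t))
    (hGK : ∀ t, G (K-1) t
      = Z (K-1) (x K) / 2 * (v (K-1) (x K) t - (1 + rL) * qL t / Z (K-1) (x K))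
        + 1/2 * (σ (K-1) (x K) t - (-(1 - rL) * qL t)))
    -- the penalized variational identities with the solution as test function
    (hvar1 : ∀ k, k < K → ∀ t ∈ Set.Ici (0:ℝ),
      (∫ y in x k..x (k+1),
        (ρ k y * v k y t * derivWithin (fun s => v k y s) (Set.Ici 0) t
          - v k y t * derivWithin (fun z => σ k z t) (Set.Icc (x k) (x (k+1))) y))
        + v k (x k) t * F k t + v k (x (k+1)) t * G k t = 0)
    (hvar2 : ∀ k, k < K → ∀ t ∈ Set.Ici (0:ℝ),
      (∫ y in x k..x (k+1),
        ((1 / μ k y) * σ k y t * derivWithin (fun s => σ k y s) (Set.Ici 0) t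
          - σ k y t * derivWithin (fun z => v k z t) (Set.Icc (x k) (x (k+1))) y))
        - σ k (x k) t / Z k (x k) * F k t + σ k (x (k+1)) t / Z k (x (k+1)) * G k t = 0)
    (E : ℝ → ℝ)
    (hE : ∀ t, E t = ∑ k ∈ Finset.range K,
      1/2 * ∫ y in x k..x (k+1), (ρ k y * (v k y t)^2 + (σ k y t)^2 / μ k y)) :
    ∀ t ∈ Set.Ici (0:ℝ),
      HasDerivWithinAt E
        (-(∑ k ∈ Finset.range K, ((F k t)^2 / Z k (x k) + (G k t)^2 / Z k (x (k+1))))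
         - (∑ i ∈ Finset.Icc 1 (K-1), α i * (Φ i t)^2 / (η i + α i)^2)
         - (1 - r₀^2) * (p₀ t)^2 / Z 0 (x 0)
         - (1 - rL^2) * (qL t)^2 / Z (K-1) (x K))
        (Set.Ici 0) t := by
  obtain ⟨n, rfl⟩ : ∃ n, K = n + 1 := ⟨K - 1, by omega⟩
  simp only [Nat.add_sub_cancel] at *
  intro t ht
  have hZpos : ∀ k, k < n + 1 → ∀ y ∈ Set.Icc (x k) (x (k+1)), 0 < Z k y := fun k hk y hy => by
    rw [hZ]
    exact Real.sqrt_pos.2 (mul_pos (hρpos k hk y hy) (hμpos k hk y hy))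
  have hZl : ∀ k, k < n + 1 → 0 < Z k (x k) := fun k hk =>
    hZpos k hk _ (Set.left_mem_Icc.2 (hxmono k hk).le)
  have hZr : ∀ k, k < n + 1 → 0 < Z k (x (k+1)) := fun k hk =>
    hZpos k hk _ (Set.right_mem_Icc.2 (hxmono k hk).le)
  have hder := HasDerivWithinAt.fun_sum (u := Finset.range (n + 1)) fun k hk => by
    have hk' := Finset.mem_range.1 hk
    exact hasDerivWithinAt_element_energy (hxmono k hk') (hρc k hk') (hμc k hk') (hμpos k hk')
      (hv k hk') (hσ k hk') ht
      (P := v k (x k) t * F k t + v k (x (k+1)) t * G k t)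
      (Q := -(σ k (x k) t / Z k (x k) * F k t) + σ k (x (k+1)) t / Z k (x (k+1)) * G k t)
      (by linarith [hvar1 k hk' t ht]) (by linarith [hvar2 k hk' t ht])
  rw [funext hE]
  refine hder.congr_deriv ?_
  let a : ℕ → ℝ := fun k =>
    if k = 0 then (1 + r₀) * p₀ t / Z 0 (x 0) * ((1 - r₀) * p₀ t) else vhp k t * σh k t
  let b : ℕ → ℝ := fun k =>
    if k = n then (1 + rL) * qL t / Z n (x (n+1)) * (-(1 - rL) * qL t)
    else vhm (k+1) t * σh (k+1) t
  have hleft : ∀ k, k < n + 1 →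
      -(v k (x k) t * σ k (x k) t) - v k (x k) t * F k t + σ k (x k) t / Z k (x k) * F k t
        = -((F k t) ^ 2 / Z k (x k)) - a k := fun k hk => by
    have hz := (hZl k hk).ne'
    rcases Nat.eq_zero_or_pos k with rfl | hk0
    · refine left_node_energy_flux hz ?_ (hF0 t)
      rw [mul_div_cancel₀ _ hz, hp₀]
      ring
    · simp only [a, if_neg hk0.ne']
      refine left_node_energy_flux hz ?_ (hFi k hk0 (by omega) t)
      rw [hvhp k hk0 (by omega), mul_div_cancel₀ _ hz, hpp k hk0 (by omega)]
      ring
  have hright : ∀ k, k < n + 1 →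
      v k (x (k+1)) t * σ k (x (k+1)) t - v k (x (k+1)) t * G k t
          - σ k (x (k+1)) t / Z k (x (k+1)) * G k t
        = -((G k t) ^ 2 / Z k (x (k+1))) + b k := fun k hk => by
    have hz := (hZr k hk).ne'
    rcases eq_or_ne k n with rfl | hkn
    · simp only [b, if_true]
      refine right_node_energy_flux hz ?_ (hGK t)
      rw [mul_div_cancel₀ _ hz, hqL]
      ring
    · simp only [b, if_neg hkn]
      refine right_node_energy_flux hz ?_ (hGi k (by omega) t)
      rw [hvhm (k+1) (by omega) (by omega), Nat.add_sub_cancel, mul_div_cancel₀ _ hz,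
        hqm (k+1) (by omega) (by omega), Nat.add_sub_cancel]
      ring
  have hfric : ∀ i ∈ Finset.Icc 1 n,
      a i - b (i - 1) = α i * (Φ i t) ^ 2 / (η i + α i) ^ 2 := fun i hi => by
    obtain ⟨h1, h2⟩ := Finset.mem_Icc.1 hi
    have hm := hZr (i - 1) (by omega)
    simp only [a, b, if_neg (by omega : i ≠ 0), if_neg (by omega : i - 1 ≠ n)]
    rw [Nat.sub_add_cancel h1] at hm ⊢
    rw [hvhp i h1 h2, hvhm i h1 h2]
    exact friction_work hm (hZl i (by omega)) (hα i h1 h2) (hη i h1 h2) (hΦ i h1 h2 t)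
      (hσh i h1 h2 t)
  have hsum := sum_range_succ_sub_eq_nodes n a b
  rw [Finset.sum_congr rfl hfric] at hsum
  have ha : a 0 = (1 - r₀ ^ 2) * (p₀ t) ^ 2 / Z 0 (x 0) := by
    simp only [a, if_true]
    ring
  have hb : b n = -((1 - rL ^ 2) * (qL t) ^ 2 / Z n (x (n+1))) := by
    simp only [b, if_true]
    ring
  calc _ = ∑ k ∈ Finset.range (n + 1),
        (-((F k t) ^ 2 / Z k (x k) + (G k t) ^ 2 / Z k (x (k+1))) + (b k - a k)) :=
        Finset.sum_congr rfl fun k hk => by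
          have hk' := Finset.mem_range.1 hk
          linarith [hleft k hk', hright k hk']
    _ = _ := by
      rw [Finset.sum_add_distrib, Finset.sum_neg_distrib, hsum, ha, hb]
      ring
end

section
/- Fix integers n ≥ 1 (n = N+1 degrees of freedom per element) and K ≥ 1 (number of elements). Let Q be a real n×n matrix and e₋, e₊ ∈ ℝⁿ vectors satisfying the summation-by-parts property Q + Qᵀ = e₊e₊ᵀ − e₋e₋ᵀ. For each k = 1,…,K let Δx_k > 0, let W_ρ^k and W_μ^k be symmetric real n×n matrices, let Z_k(−1) > 0 and Z_k(1) > 0, and let v^k, σ^k : [0,∞) → ℝⁿ be differentiable. Write v^k(∓1,t) = e∓ · v^k(t) and σ^k(∓1,t) = e∓ · σ^k(t) for the boundary traces. Let r₀, r_L ∈ [−1,1] and, for each interior interface between elements k and k+1 (1 ≤ k ≤ K−1), let α_{k+1} ≥ 0 and define: Z⁻ = Z_k(1), Z⁺ = Z_{k+1}(−1), q⁻ = ½(Z⁻ v^k(1,t) − σ^k(1,t)), p⁺ = ½(Z⁺ v^{k+1}(−1,t) + σ^{k+1}(−1,t)), η_{k+1} = Z⁻Z⁺/(Z⁻+Z⁺),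 Φ_{k+1} = η_{k+1}(2p⁺/Z⁺ − 2q⁻/Z⁻), σ̂ = α_{k+1}Φ_{k+1}/(η_{k+1}+α_{k+1}), v̂⁻ = (2q⁻+σ̂)/Z⁻, v̂⁺ = (2p⁺−σ̂)/Z⁺, and the fluctuations G^k(t) = (Z⁻/2)(v^k(1,t) − v̂⁻) + ½(σ^k(1,t) − σ̂) and F^{k+1}(t) = (Z⁺/2)(v^{k+1}(−1,t) − v̂⁺) − ½(σ^{k+1}(−1,t) − σ̂). At the left external boundary set p₀ = ½(Z₁(−1)v¹(−1,t) + σ¹(−1,t)), v̂ = (1+r₀)p₀/Z₁(−1), σ̂ = (1−r₀)p₀, F¹(t) = (Z₁(−1)/2)(v¹(−1,t) − v̂) − ½(σ¹(−1,t) − σ̂); at the right external boundary set q_L = ½(Z_K(1)v^K(1,t) − σ^K(1,t)), v̂ = (1+r_L)q_L/Z_K(1), σ̂ = −(1−r_L)q_L, G^K(t) = (Z_K(1)/2)(v^K(1,t) − v̂) + ½(σ^K(1,t) − σ̂). Assume the semi-discrete equations hold for every t ≥ 0 and every k: (Δx_k/2) W_ρ^k (dv^k/dt) = Q σ^k − e₋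 F^k − e₊ G^k and (Δx_k/2) W_μ^k (dσ^k/dt) = Q v^k + e₋ F^k/Z_k(−1) − e₊ G^k/Z_k(1). Then the discrete energy 𝓔(t) = ∑_{k=1}^{K} (Δx_k/2)( ½ v^k(t)ᵀ W_ρ^k v^k(t) + ½ σ^k(t)ᵀ W_μ^k σ^k(t) ) satisfies, for every t ≥ 0, d𝓔/dt = −∑_{k=1}^{K} ( |F^k(t)|²/Z_k(−1) + |G^k(t)|²/Z_k(1) ) − ∑_{k=2}^{K} α_k Φ_k²/(η_k+α_k)² − (1−r₀²) p₀²/Z₁(−1) − (1−r_L²) q_L²/Z_K(1). -/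
open Matrix

theorem hasDerivWithinAt_dotProduct {n : ℕ} {f g : ℝ → (Fin n → ℝ)} {f' g' : Fin n → ℝ}
    {s : Set ℝ} {t : ℝ} (hf : HasDerivWithinAt f f' s t) (hg : HasDerivWithinAt g g' s t) :
    HasDerivWithinAt (fun t => f t ⬝ᵥ g t) (f' ⬝ᵥ g t + f t ⬝ᵥ g') s t := by
  rw [hasDerivWithinAt_pi] at hf hg
  simp only [dotProduct, ← Finset.sum_add_distrib]
  exact HasDerivWithinAt.fun_sum fun i _ => (hf i).mul (hg i)

theorem hasDerivWithinAt_mulVec {n : ℕ} (A : Matrix (Fin n) (Fin n) ℝ)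
    {f : ℝ → (Fin n → ℝ)} {f' : Fin n → ℝ} {s : Set ℝ} {t : ℝ}
    (hf : HasDerivWithinAt f f' s t) :
    HasDerivWithinAt (fun t => A.mulVec (f t)) (A.mulVec f') s t := by
  rw [hasDerivWithinAt_pi] at hf ⊢
  intro i
  simp only [Matrix.mulVec, dotProduct]
  exact HasDerivWithinAt.fun_sum fun j _ => (hf j).const_mul (A i j)

theorem dotProduct_mulVec_comm_of_isSymm {n : ℕ} {A : Matrix (Fin n) (Fin n) ℝ} (hA : A.IsSymm)
    (x y : Fin n → ℝ) : x ⬝ᵥ A.mulVec y = y ⬝ᵥ A.mulVec x := by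
  rw [Matrix.dotProduct_mulVec, ← Matrix.mulVec_transpose, hA.eq, dotProduct_comm]

/-- For a symmetric matrix, the derivative of half the quadratic form along a curve. -/
theorem hasDerivWithinAt_half_quadratic {n : ℕ} {A : Matrix (Fin n) (Fin n) ℝ} (hA : A.IsSymm)
    {f : ℝ → (Fin n → ℝ)} {f' : Fin n → ℝ} {s : Set ℝ} {t : ℝ}
    (hf : HasDerivWithinAt f f' s t) :
    HasDerivWithinAt (fun t => 1 / 2 * (f t ⬝ᵥ A.mulVec (f t))) (f t ⬝ᵥ A.mulVec f') s t := by
  refine ((hasDerivWithinAt_dotProduct hf (hasDerivWithinAt_mulVec A hf)).const_mul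
    (1 / 2 : ℝ)).congr_deriv ?_
  rw [dotProduct_mulVec_comm_of_isSymm hA f' (f t)]
  ring

/-- Discrete integration by parts in bilinear form. -/
theorem dotProduct_mulVec_add_of_summation_by_parts {n : ℕ} {Q : Matrix (Fin n) (Fin n) ℝ}
    {em ep : Fin n → ℝ}
    (hSBP : Q + Qᵀ = Matrix.vecMulVec ep ep - Matrix.vecMulVec em em) (x y : Fin n → ℝ) :
    x ⬝ᵥ Q.mulVec y + y ⬝ᵥ Q.mulVec x
      = (ep ⬝ᵥ x) * (ep ⬝ᵥ y) - (em ⬝ᵥ x) * (em ⬝ᵥ y) := by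
  have h : y ⬝ᵥ Q.mulVec x = x ⬝ᵥ Qᵀ.mulVec y := by
    rw [Matrix.dotProduct_mulVec, ← Matrix.mulVec_transpose, dotProduct_comm]
  rw [h, ← dotProduct_add, ← Matrix.add_mulVec, hSBP, Matrix.sub_mulVec, dotProduct_sub,
    Matrix.vecMulVec_mulVec, Matrix.vecMulVec_mulVec]
  simp only [op_smul_eq_smul, smul_dotProduct, smul_eq_mul, dotProduct_comm x]
  ring

/-- Energy balance at a left element endpoint, with the outgoing characteristic reflected with
coefficient `r`. -/
theorem left_boundary_energy_balance {Z v s r p F : ℝ} (hZ : 0 < Z)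
    (hp : p = 1 / 2 * (Z * v + s))
    (hF : F = Z / 2 * (v - (1 + r) * p / Z) - 1 / 2 * (s - (1 - r) * p)) :
    -(v * s) - F * v + F / Z * s = -(F ^ 2 / Z) - (1 - r ^ 2) * p ^ 2 / Z := by
  subst hF hp
  field_simp
  ring

/-- Energy balance at a right element endpoint, with the outgoing characteristic reflected with
coefficient `r`. -/
theorem right_boundary_energy_balance {Z v s r q G : ℝ} (hZ : 0 < Z)
    (hq : q = 1 / 2 * (Z * v - s))
    (hG : G = Z / 2 * (v - (1 + r) * q / Z) + 1 / 2 * (s - (-(1 - r) * q))) :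
    v * s - G * v - G / Z * s = -(G ^ 2 / Z) - (1 - r ^ 2) * q ^ 2 / Z := by
  subst hG hq
  field_simp
  ring

/-- Energy balance at a left element endpoint, with hat-variables `vh`, `sh` preserving the
outgoing characteristic. -/
theorem left_energy_balance {Z v s p vh sh F : ℝ} (hZ : 0 < Z)
    (hp : p = 1 / 2 * (Z * v + s)) (hvh : vh = (2 * p - sh) / Z)
    (hF : F = Z / 2 * (v - vh) - 1 / 2 * (s - sh)) :
    -(v * s) - F * v + F / Z * s = -(F ^ 2 / Z) - vh * sh := by
  subst hF hvh hp
  field_simp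
  ring

/-- Energy balance at a right element endpoint, with hat-variables `vh`, `sh` preserving the
outgoing characteristic. -/
theorem right_energy_balance {Z v s q vh sh G : ℝ} (hZ : 0 < Z)
    (hq : q = 1 / 2 * (Z * v - s)) (hvh : vh = (2 * q + sh) / Z)
    (hG : G = Z / 2 * (v - vh) + 1 / 2 * (s - sh)) :
    v * s - G * v - G / Z * s = -(G ^ 2 / Z) + vh * sh := by
  subst hG hvh hq
  field_simp
  ring

/-- The energy dissipated by friction at an interface. -/
theorem interface_dissipation {Zl Zr q p η α Φ sh vhl vhr : ℝ} (hZl : 0 < Zl) (hZr : 0 < Zr)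
    (hα : 0 ≤ α) (hη : η = Zl * Zr / (Zl + Zr)) (hΦ : Φ = η * (2 * p / Zr - 2 * q / Zl))
    (hsh : sh = α * Φ / (η + α)) (hvhl : vhl = (2 * q + sh) / Zl)
    (hvhr : vhr = (2 * p - sh) / Zr) :
    (vhr - vhl) * sh = α * Φ ^ 2 / (η + α) ^ 2 := by
  have hη0 : 0 < η := by rw [hη]; positivity
  have hη' : η * (1 / Zr + 1 / Zl) = 1 := by rw [hη]; field_simp
  have hηα : η + α ≠ 0 := by positivity
  have hjump : η * (vhr - vhl) = Φ - sh := by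
    rw [hvhr, hvhl, hΦ]
    linear_combination (-sh) * hη'
  have hjump' : vhr - vhl = Φ / (η + α) := by
    have : η * (vhr - vhl) = η * (Φ / (η + α)) := by
      rw [hjump, hsh]; field_simp; ring
    exact mul_left_cancel₀ hη0.ne' this
  rw [hjump', hsh]
  field_simp

theorem sum_Icc_one_eq_sum_range (f : ℕ → ℝ) (m : ℕ) :
    ∑ i ∈ Finset.Icc 1 m, f i = ∑ k ∈ Finset.range m, f (k + 1) := by
  rw [Finset.range_eq_Ico, Finset.sum_Ico_add' f 0 m 1, zero_add]
  rfl

/-- Theorem 2 of the paper: the semi-discrete energy identity for the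
DG approximation of the 1D elastic wave equation with physically motivated fluxes.
Elements are indexed `k = 0, …, K-1`; interior interfaces (between elements `i-1`
and `i`) are indexed `i = 1, …, K-1`. -/
theorem stmt_15 (n K : ℕ) (hn : 1 ≤ n) (hK : 1 ≤ K)
    (Q : Matrix (Fin n) (Fin n) ℝ) (em ep : Fin n → ℝ)
    (hSBP : Q + Qᵀ = Matrix.vecMulVec ep ep - Matrix.vecMulVec em em)
    (Δx : ℕ → ℝ) (hΔx : ∀ k, k < K → 0 < Δx k)
    (Wρ Wμ : ℕ → Matrix (Fin n) (Fin n) ℝ)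
    (hWρ : ∀ k, k < K → (Wρ k).IsSymm) (hWμ : ∀ k, k < K → (Wμ k).IsSymm)
    (Zm Zp : ℕ → ℝ) (hZm : ∀ k, k < K → 0 < Zm k) (hZp : ∀ k, k < K → 0 < Zp k)
    (v σ v' σ' : ℕ → ℝ → (Fin n → ℝ))
    (hv : ∀ k, k < K → ∀ t ∈ Set.Ici (0:ℝ),
      HasDerivWithinAt (v k) (v' k t) (Set.Ici 0) t)
    (hσ : ∀ k, k < K → ∀ t ∈ Set.Ici (0:ℝ),
      HasDerivWithinAt (σ k) (σ' k t) (Set.Ici 0) t)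
    (r₀ rL : ℝ) (hr₀ : r₀ ∈ Set.Icc (-1:ℝ) 1) (hrL : rL ∈ Set.Icc (-1:ℝ) 1)
    (α : ℕ → ℝ) (hα : ∀ i, 1 ≤ i → i ≤ K - 1 → 0 ≤ α i)
    -- outgoing characteristics at the interior interface `i` (`1 ≤ i ≤ K-1`)
    (qm pp : ℕ → ℝ → ℝ)
    (hqm : ∀ i, 1 ≤ i → i ≤ K - 1 → ∀ t,
      qm i t = 1/2 * (Zp (i-1) * (ep ⬝ᵥ v (i-1) t) - ep ⬝ᵥ σ (i-1) t))
    (hpp : ∀ i, 1 ≤ i → i ≤ K - 1 → ∀ t,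
      pp i t = 1/2 * (Zm i * (em ⬝ᵥ v i t) + em ⬝ᵥ σ i t))
    (η : ℕ → ℝ)
    (hη : ∀ i, 1 ≤ i → i ≤ K - 1 → η i = Zp (i-1) * Zm i / (Zp (i-1) + Zm i))
    (Φ : ℕ → ℝ → ℝ)
    (hΦ : ∀ i, 1 ≤ i → i ≤ K - 1 → ∀ t,
      Φ i t = η i * (2 * pp i t / Zm i - 2 * qm i t / Zp (i-1)))
    (σh : ℕ → ℝ → ℝ)
    (hσh : ∀ i, 1 ≤ i → i ≤ K - 1 → ∀ t, σh i t = α i * Φ i t / (η i + α i))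
    (vhm vhp : ℕ → ℝ → ℝ)
    (hvhm : ∀ i, 1 ≤ i → i ≤ K - 1 → ∀ t, vhm i t = (2 * qm i t + σh i t) / Zp (i-1))
    (hvhp : ∀ i, 1 ≤ i → i ≤ K - 1 → ∀ t, vhp i t = (2 * pp i t - σh i t) / Zm i)
    -- outgoing characteristics at the external boundaries
    (p₀ qL : ℝ → ℝ)
    (hp₀ : ∀ t, p₀ t = 1/2 * (Zm 0 * (em ⬝ᵥ v 0 t) + em ⬝ᵥ σ 0 t))
    (hqL : ∀ t, qL t = 1/2 * (Zp (K-1) * (ep ⬝ᵥ v (K-1) t) - ep ⬝ᵥ σ (K-1) t))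
    -- flux fluctuations
    (F G : ℕ → ℝ → ℝ)
    (hF0 : ∀ t, F 0 t
      = Zm 0 / 2 * (em ⬝ᵥ v 0 t - (1 + r₀) * p₀ t / Zm 0)
        - 1/2 * (em ⬝ᵥ σ 0 t - (1 - r₀) * p₀ t))
    (hFi : ∀ k, 1 ≤ k → k ≤ K - 1 → ∀ t, F k t
      = Zm k / 2 * (em ⬝ᵥ v k t - vhp k t) - 1/2 * (em ⬝ᵥ σ k t - σh k t))
    (hGi : ∀ k, k < K - 1 → ∀ t, G k t
      = Zp k / 2 * (ep ⬝ᵥ v k t - vhm (k+1) t) + 1/2 * (ep ⬝ᵥ σ k t - σh (k+1) t))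
    (hGK : ∀ t, G (K-1) t
      = Zp (K-1) / 2 * (ep ⬝ᵥ v (K-1) t - (1 + rL) * qL t / Zp (K-1))
        + 1/2 * (ep ⬝ᵥ σ (K-1) t - (-(1 - rL) * qL t)))
    -- the semi-discrete equations
    (hode1 : ∀ k, k < K → ∀ t ∈ Set.Ici (0:ℝ),
      (Δx k / 2) • (Wρ k).mulVec (v' k t)
        = Q.mulVec (σ k t) - F k t • em - G k t • ep)
    (hode2 : ∀ k, k < K → ∀ t ∈ Set.Ici (0:ℝ),
      (Δx k / 2) • (Wμ k).mulVec (σ' k t)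
        = Q.mulVec (v k t) + (F k t / Zm k) • em - (G k t / Zp k) • ep)
    (𝓔 : ℝ → ℝ)
    (h𝓔 : ∀ t, 𝓔 t = ∑ k ∈ Finset.range K, Δx k / 2 *
      (1/2 * (v k t ⬝ᵥ (Wρ k).mulVec (v k t)) + 1/2 * (σ k t ⬝ᵥ (Wμ k).mulVec (σ k t)))) :
    ∀ t ∈ Set.Ici (0:ℝ),
      HasDerivWithinAt 𝓔
        (-(∑ k ∈ Finset.range K, ((F k t)^2 / Zm k + (G k t)^2 / Zp k))
         - (∑ i ∈ Finset.Icc 1 (K-1), α i * (Φ i t)^2 / (η i + α i)^2)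
         - (1 - r₀^2) * (p₀ t)^2 / Zm 0
         - (1 - rL^2) * (qL t)^2 / Zp (K-1))
        (Set.Ici 0) t := by
  intro t ht
  obtain ⟨m, rfl⟩ : ∃ m, K = m + 1 := ⟨K - 1, by omega⟩
  simp only [Nat.add_sub_cancel] at *
  set L : ℕ → ℝ := fun k => -((em ⬝ᵥ v k t) * (em ⬝ᵥ σ k t)) - F k t * (em ⬝ᵥ v k t)
    + F k t / Zm k * (em ⬝ᵥ σ k t) with hL
  set R : ℕ → ℝ := fun k => (ep ⬝ᵥ v k t) * (ep ⬝ᵥ σ k t) - G k t * (ep ⬝ᵥ v k t)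
    - G k t / Zp k * (ep ⬝ᵥ σ k t) with hR
  have hderiv : HasDerivWithinAt 𝓔 (∑ k ∈ Finset.range (m + 1), (L k + R k)) (Set.Ici 0) t := by
    rw [funext h𝓔]
    refine HasDerivWithinAt.fun_sum fun k hk => ?_
    have hk := Finset.mem_range.mp hk
    refine (((hasDerivWithinAt_half_quadratic (hWρ k hk) (hv k hk t ht)).add
      (hasDerivWithinAt_half_quadratic (hWμ k hk) (hσ k hk t ht))).const_mul (Δx k / 2)).congr_deriv ?_
    have h1 := congrArg (v k t ⬝ᵥ ·) (hode1 k hk t ht)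
    have h2 := congrArg (σ k t ⬝ᵥ ·) (hode2 k hk t ht)
    simp only [dotProduct_smul, dotProduct_sub, dotProduct_add, smul_eq_mul,
      dotProduct_comm _ em, dotProduct_comm _ ep] at h1 h2
    have h3 := dotProduct_mulVec_add_of_summation_by_parts hSBP (v k t) (σ k t)
    simp only [hL, hR]
    linear_combination h1 + h2 + h3
  refine hderiv.congr_deriv ?_
  have hL0 : L 0 = -((F 0 t) ^ 2 / Zm 0) - (1 - r₀ ^ 2) * (p₀ t) ^ 2 / Zm 0 :=
    left_boundary_energy_balance (hZm 0 (by omega)) (hp₀ t) (hF0 t)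
  have hRm : R m = -((G m t) ^ 2 / Zp m) - (1 - rL ^ 2) * (qL t) ^ 2 / Zp m :=
    right_boundary_energy_balance (hZp m (by omega)) (hqL t) (hGK t)
  have hint : ∀ k ∈ Finset.range m, L (k + 1) + R k
      = -((F (k + 1) t) ^ 2 / Zm (k + 1)) - (G k t) ^ 2 / Zp k
        - α (k + 1) * (Φ (k + 1) t) ^ 2 / (η (k + 1) + α (k + 1)) ^ 2 := by
    intro k hk
    have hk := Finset.mem_range.mp hk
    have h1 : 1 ≤ k + 1 := by omega
    have h2 : k + 1 ≤ m := by omega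
    have hl := left_energy_balance (hZm (k + 1) (by omega)) (hpp _ h1 h2 t) (hvhp _ h1 h2 t)
      (hFi _ h1 h2 t)
    have hr := right_energy_balance (hZp k (by omega)) (hqm _ h1 h2 t) (hvhm _ h1 h2 t)
      (hGi k hk t)
    have hi := interface_dissipation (hZp k (by omega)) (hZm (k + 1) (by omega)) (hα _ h1 h2)
      (hη _ h1 h2) (hΦ _ h1 h2 t) (hσh _ h1 h2 t) (hvhm _ h1 h2 t) (hvhp _ h1 h2 t)
    simp only [Nat.add_sub_cancel] at hr
    simp only [hL, hR]
    linear_combination hl + hr - hi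
  clear_value L R
  have hsum := Finset.sum_congr rfl hint
  simp only [Finset.sum_add_distrib, Finset.sum_sub_distrib, Finset.sum_neg_distrib] at hsum
  rw [sum_Icc_one_eq_sum_range, Finset.sum_add_distrib, Finset.sum_add_distrib,
    Finset.sum_range_succ' L, Finset.sum_range_succ R,
    Finset.sum_range_succ' (fun k => (F k t) ^ 2 / Zm k),
    Finset.sum_range_succ (fun k => (G k t) ^ 2 / Zp k)]
  linear_combination hsum + hL0 + hRm
end
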